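/- arXiv:1305.6022 — 5 statements merged into one kernel-verified Lean document; each statement's English description precedes it below -/
import Mathlib

section
/- Let A ⊆ B be an extension of unital associative k-algebras with dim_k(A) = n and dim_k(B) = n + m for positive integers m and n. Then there exists an injective group homomorphism from Gal(B/A) into the group whose underlying set is M_{n×m}(k) × GL_m(k) with multiplication (R, P) · (R', P') := (R' + R P', P P'), i.e. the semidirect product GL(m, k) ⋉ M_{n×m}(k) of GL(m, k) with the additive group of n×m matrices over k. -/
universe u v

variable (k : Type u) [Field k]

/-- The Galois group `Gal(B/A)` of an extension `A ⊆ B` of algebras: the subgroup of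
algebra automorphisms of `B` fixing `A` pointwise. -/
def galoisGroup (B : Type v) [Ring B] [Algebra k B] (A : Subalgebra k B) :
    Subgroup (B ≃ₐ[k] B) where
  carrier := {σ | ∀ a ∈ A, σ a = a}
  one_mem' := fun _ _ => rfl
  mul_mem' := by
    intro σ τ hσ hτ a ha
    show σ (τ a) = a
    rw [hτ a ha, hσ a ha]
  inv_mem' := by
    intro σ hσ a ha
    show σ.symm a = a
    exact σ.injective (by rw [AlgEquiv.apply_symm_apply, hσ a ha])

/-- A basis of `V` adapted to a subspace `W`: the left summand of the index type
is sent into `W`. -/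
theorem Submodule.exists_basis_sum_inl_mem {k : Type*} [Field k] {V : Type*} [AddCommGroup V]
    [Module k V] [Module.Finite k V] (W : Submodule k V) {n m : ℕ}
    (hW : Module.finrank k W = n) (hV : Module.finrank k V = n + m) :
    ∃ b : Module.Basis (Fin n ⊕ Fin m) k V, ∀ i, b (Sum.inl i) ∈ W := by
  obtain ⟨C, hC⟩ := W.exists_isCompl
  have hCm : Module.finrank k C = m := by
    have := Submodule.finrank_add_eq_of_isCompl hC
    omega
  refine ⟨((Module.finBasisOfFinrankEq k W hW).prod (Module.finBasisOfFinrankEq k C hCm)).map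
    (Submodule.prodEquivOfIsCompl W C hC), fun i => ?_⟩
  simp

section GaloisMatrix

variable {k : Type*} [Field k] {B : Type*} [Ring B] [Algebra k B] {A : Subalgebra k B}
  {ι κ : Type*} [Fintype ι] [Fintype κ] [DecidableEq ι] [DecidableEq κ]

/-- The matrix of an element of the Galois group with respect to a basis. -/
noncomputable def galoisMatrix (A : Subalgebra k B) (b : Module.Basis (ι ⊕ κ) k B) :
    galoisGroup k B A →* Matrix (ι ⊕ κ) (ι ⊕ κ) k where
  toFun σ := LinearMap.toMatrix b b σ.1.toLinearMap
  map_one' := LinearMap.toMatrix_one b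
  map_mul' σ τ := LinearMap.toMatrix_mul b σ.1.toLinearMap τ.1.toLinearMap

theorem galoisMatrix_injective (b : Module.Basis (ι ⊕ κ) k B) :
    Function.Injective (galoisMatrix A b) := fun _ _ h =>
  Subtype.ext (AlgEquiv.toLinearMap_injective ((LinearMap.toMatrix b b).injective h))

theorem galoisMatrix_eq_fromBlocks {b : Module.Basis (ι ⊕ κ) k B}
    (hb : ∀ i, b (Sum.inl i) ∈ A) (σ : galoisGroup k B A) :
    galoisMatrix A b σ = Matrix.fromBlocks 1 (galoisMatrix A b σ).toBlocks₁₂ 0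
      (galoisMatrix A b σ).toBlocks₂₂ := by
  have key (x : ι ⊕ κ) (i : ι) : galoisMatrix A b σ x (Sum.inl i) =
      (1 : Matrix (ι ⊕ κ) (ι ⊕ κ) k) x (Sum.inl i) := by
    have h : σ.1 (b (Sum.inl i)) = b (Sum.inl i) := σ.2 _ (hb i)
    change LinearMap.toMatrix b b σ.1.toLinearMap x (Sum.inl i) = _
    simp [LinearMap.toMatrix_apply, h, Matrix.one_apply, Finsupp.single_apply, eq_comm]
  ext (x | x) (y | y)
  · simp [key, Matrix.one_apply]
  · rfl
  · simp [key]
  · rfl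

theorem galoisMatrix_mul_eq_fromBlocks {b : Module.Basis (ι ⊕ κ) k B}
    (hb : ∀ i, b (Sum.inl i) ∈ A) (σ τ : galoisGroup k B A) :
    galoisMatrix A b (σ * τ) = Matrix.fromBlocks 1
      ((galoisMatrix A b τ).toBlocks₁₂ +
        (galoisMatrix A b σ).toBlocks₁₂ * (galoisMatrix A b τ).toBlocks₂₂) 0
      ((galoisMatrix A b σ).toBlocks₂₂ * (galoisMatrix A b τ).toBlocks₂₂) := by
  rw [map_mul, galoisMatrix_eq_fromBlocks hb σ, galoisMatrix_eq_fromBlocks hb τ,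
    Matrix.fromBlocks_multiply]
  simp

/-- The lower right block of `galoisMatrix`, as a homomorphism to the general linear group. -/
noncomputable def galoisBlock {b : Module.Basis (ι ⊕ κ) k B}
    (hb : ∀ i, b (Sum.inl i) ∈ A) : galoisGroup k B A →* GL κ k :=
  MonoidHom.toHomUnits
    { toFun := fun σ => (galoisMatrix A b σ).toBlocks₂₂
      map_one' := by
        rw [map_one, ← Matrix.fromBlocks_one, Matrix.toBlocks_fromBlocks₂₂]
      map_mul' := fun σ τ => by
        rw [galoisMatrix_mul_eq_fromBlocks hb, Matrix.toBlocks_fromBlocks₂₂] }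

theorem coe_galoisBlock {b : Module.Basis (ι ⊕ κ) k B}
    (hb : ∀ i, b (Sum.inl i) ∈ A) (σ : galoisGroup k B A) :
    (galoisBlock hb σ : Matrix κ κ k) = (galoisMatrix A b σ).toBlocks₂₂ :=
  rfl

end GaloisMatrix

/-- **Corollary**.  If `A ⊆ B` is an extension of algebras with `dim_k A = n` and
`dim_k B = n + m` (`n, m > 0`), then `Gal(B/A)` embeds as a group into the semidirect
product `GL(m, k) ⋉ M_{n×m}(k)`, realized as the set `M_{n×m}(k) × GL(m,k)` with
multiplication `(R, P) · (R', P') = (R' + R ⬝ P', P ⬝ P')`. -/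
theorem galois_group_embeds_in_semidirect_product
    (B : Type v) [Ring B] [Algebra k B] (A : Subalgebra k B) (n m : ℕ)
    (hn : 0 < n) (hm : 0 < m)
    (hA : Module.finrank k A = n) (hB : Module.finrank k B = n + m) :
    ∃ f : galoisGroup k B A → Matrix (Fin n) (Fin m) k × GL (Fin m) k,
      Function.Injective f ∧
      ∀ σ τ : galoisGroup k B A,
        f (σ * τ) = ((f τ).1 + (f σ).1 * ((f τ).2 : Matrix (Fin m) (Fin m) k),
          (f σ).2 * (f τ).2) := by
  have : Module.Finite k B := Module.finite_of_finrank_pos (by omega)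
  obtain ⟨b, hb⟩ := (Subalgebra.toSubmodule A).exists_basis_sum_inl_mem hA hB
  replace hb : ∀ i, b (Sum.inl i) ∈ A := hb
  refine ⟨fun σ => ((galoisMatrix A b σ).toBlocks₁₂, galoisBlock hb σ), fun σ τ h => ?_,
    fun σ τ => Prod.ext ?_ (map_mul _ σ τ)⟩
  · obtain ⟨hR, hP⟩ := Prod.ext_iff.1 h
    apply galoisMatrix_injective b
    rw [galoisMatrix_eq_fromBlocks hb σ, galoisMatrix_eq_fromBlocks hb τ,
      ← coe_galoisBlock hb σ, ← coe_galoisBlock hb τ]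
    exact congrArg₂ (fun R (P : GL (Fin m) k) => Matrix.fromBlocks 1 R 0 P.1) hR hP
  · simp only [galoisMatrix_mul_eq_fromBlocks hb, Matrix.toBlocks_fromBlocks₁₂, coe_galoisBlock]
end

section
/- Let A be a unital associative k-algebra and V a (not necessarily unital) associative k-algebra. A unital associative k-algebra E factorizes through A and V (i.e. E contains A as a unital subalgebra and V as a subalgebra such that E = A + V and A ∩ V = {0}) if and only if there exists a matched pair of algebras (A, V, ⊲, ⊳, ↼, ⇀) such that E is isomorphic as a k-algebra to the bicrossed product A ⋈ V, namely the k-vector space A × V with unit (1_A, 0) and multiplication (a, x) • (b, y) := (ab + a ↼ y + x ⊳ b, a ⇀ y + x ⊲ b + x · y). -/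
universe u v w

variable (k : Type u) [Field k] (A : Type v) [Ring A] [Algebra k A]
  (V : Type w) [NonUnitalRing V] [Module k V] [IsScalarTower k V V] [SMulCommClass k V V]

/-- A matched pair of algebras `(A, V, ⊲, ⊳, ↼, ⇀)`: a unital algebra `A`, a
(not necessarily unital) associative algebra `V` and four bilinear maps such that
`(V, ⇀, ⊲)` is a unital `A`-bimodule, `(A, ⊳, ↼)` is a `V`-bimodule and the
compatibility conditions (MP1)–(MP6) hold. -/
structure MatchedPair where
  /-- `x ⊲ a : V` -/
  rAct : V →ₗ[k] A →ₗ[k] V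
  /-- `x ⊳ a : A` -/
  rHook : V →ₗ[k] A →ₗ[k] A
  /-- `a ↼ x : A` -/
  lHook : A →ₗ[k] V →ₗ[k] A
  /-- `a ⇀ x : V` -/
  lAct : A →ₗ[k] V →ₗ[k] V
  -- `(V, ⇀, ⊲)` is a unital `A`-bimodule:
  lAct_one : ∀ x : V, lAct 1 x = x
  lAct_mul : ∀ (a b : A) (x : V), lAct (a * b) x = lAct a (lAct b x)
  rAct_one : ∀ x : V, rAct x 1 = x
  rAct_mul : ∀ (a b : A) (x : V), rAct x (a * b) = rAct (rAct x a) b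
  lAct_rAct : ∀ (a b : A) (x : V), lAct a (rAct x b) = rAct (lAct a x) b
  -- `(A, ⊳, ↼)` is a `V`-bimodule:
  rHook_vMul : ∀ (x y : V) (a : A), rHook (x * y) a = rHook x (rHook y a)
  lHook_vMul : ∀ (a : A) (x y : V), lHook (lHook a x) y = lHook a (x * y)
  rHook_lHook : ∀ (x : V) (a : A) (y : V), lHook (rHook x a) y = rHook x (lHook a y)
  -- (MP1)
  mp1 : ∀ (a : A) (x y : V), lAct a (x * y) = lAct a x * y + lAct (lHook a x) y
  -- (MP2)
  mp2 : ∀ (a b : A) (x : V), lHook (a * b) x = a * lHook b x + lHook a (lAct b x)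
  -- (MP3)
  mp3 : ∀ (x : V) (a b : A), rHook x (a * b) = rHook x a * b + rHook (rAct x a) b
  -- (MP4)
  mp4 : ∀ (x y : V) (a : A), rAct (x * y) a = rAct x (rHook y a) + x * rAct y a
  -- (MP5)
  mp5 : ∀ (a : A) (x : V) (b : A),
    a * rHook x b + lHook a (rAct x b) = lHook a x * b + rHook (lAct a x) b
  -- (MP6)
  mp6 : ∀ (x : V) (a : A) (y : V),
    rAct x (lHook a y) + x * lAct a y = lAct (rHook x a) y + rAct x a * y

variable {k A V}

/-- The multiplication of the bicrossed product `A ⋈ V`: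
`(a, x) • (b, y) = (ab + a ↼ y + x ⊳ b, a ⇀ y + x ⊲ b + x · y)`. -/
def MatchedPair.mul (mp : MatchedPair k A V) (p q : A × V) : A × V :=
  (p.1 * q.1 + mp.lHook p.1 q.2 + mp.rHook p.2 q.1,
   mp.lAct p.1 q.2 + mp.rAct p.2 q.1 + p.2 * q.2)

/-- Bilinear maps describing the mixed products of the images of `A` and `V` in an algebra `E`,
where `A × V → E` is injective, form a matched pair. -/
def MatchedPair.ofMulEq {E : Type*} [Ring E] [Algebra k E]
    (i : A →ₐ[k] E) (j : V →ₗ[k] E) (hj : ∀ x y : V, j (x * y) = j x * j y)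
    (hinj : ∀ (a b : A) (x y : V), i a + j x = i b + j y → a = b ∧ x = y)
    (rAct : V →ₗ[k] A →ₗ[k] V) (rHook : V →ₗ[k] A →ₗ[k] A)
    (lHook : A →ₗ[k] V →ₗ[k] A) (lAct : A →ₗ[k] V →ₗ[k] V)
    (hij : ∀ a x, i a * j x = i (lHook a x) + j (lAct a x))
    (hji : ∀ x a, j x * i a = i (rHook x a) + j (rAct x a)) : MatchedPair k A V :=
  have hl (x : V) : lHook 1 x = 0 ∧ lAct 1 x = x := hinj _ _ _ _ <| by simp [← hij]
  have hr (x : V) : rHook x 1 = 0 ∧ rAct x 1 = x := hinj _ _ _ _ <| by simp [← hji]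
  have iij (a b : A) (x : V) :
      lHook (a * b) x = a * lHook b x + lHook a (lAct b x) ∧
        lAct (a * b) x = lAct a (lAct b x) := hinj _ _ _ _ <| by
    have h := mul_assoc (i a) (i b) (j x)
    simp only [← map_mul, hij, mul_add] at h
    simp only [map_add]
    grind
  have iji (a : A) (x : V) (b : A) :
      lHook a x * b + rHook (lAct a x) b = a * rHook x b + lHook a (rAct x b) ∧
        rAct (lAct a x) b = lAct a (rAct x b) := hinj _ _ _ _ <| by
    have h := mul_assoc (i a) (j x) (i b)
    simp only [← map_mul, hij, hji, add_mul, mul_add] at h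
    simp only [map_add]
    grind
  have jii (x : V) (a b : A) :
      rHook x a * b + rHook (rAct x a) b = rHook x (a * b) ∧
        rAct (rAct x a) b = rAct x (a * b) := hinj _ _ _ _ <| by
    have h := mul_assoc (j x) (i a) (i b)
    simp only [← map_mul, hji, add_mul] at h
    simp only [map_add]
    grind
  have ijj (a : A) (x y : V) :
      lHook (lHook a x) y = lHook a (x * y) ∧
        lAct (lHook a x) y + lAct a x * y = lAct a (x * y) := hinj _ _ _ _ <| by
    have h := mul_assoc (i a) (j x) (j y)
    simp only [← hj, hij, add_mul] at h
    simp only [map_add]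
    grind
  have jij (x : V) (a : A) (y : V) :
      lHook (rHook x a) y = rHook x (lHook a y) ∧
        lAct (rHook x a) y + rAct x a * y = rAct x (lHook a y) + x * lAct a y := hinj _ _ _ _ <| by
    have h := mul_assoc (j x) (i a) (j y)
    simp only [← hj, hij, hji, add_mul, mul_add] at h
    simp only [map_add]
    grind
  have jji (x y : V) (a : A) :
      rHook (x * y) a = rHook x (rHook y a) ∧
        rAct (x * y) a = rAct x (rHook y a) + x * rAct y a := hinj _ _ _ _ <| by
    have h := mul_assoc (j x) (j y) (i a)
    simp only [← hj, hji, mul_add] at h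
    simp only [map_add]
    grind
  { rAct, rHook, lHook, lAct
    lAct_one := fun x => (hl x).2
    lAct_mul := fun a b x => (iij a b x).2
    rAct_one := fun x => (hr x).2
    rAct_mul := fun a b x => (jii x a b).2.symm
    lAct_rAct := fun a b x => (iji a x b).2.symm
    rHook_vMul := fun x y a => (jji x y a).1
    lHook_vMul := fun a x y => (ijj a x y).1
    rHook_lHook := fun x a y => (jij x a y).1
    mp1 := fun a x y => by rw [add_comm]; exact (ijj a x y).2.symm
    mp2 := fun a b x => (iij a b x).1
    mp3 := fun x a b => (jii x a b).1.symm
    mp4 := fun x y a => (jji x y a).2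
    mp5 := fun a x b => (iji a x b).1.symm
    mp6 := fun x a y => (jij x a y).2.symm }

/-- A factorization of `E` as `i(A) ⊕ j(V)` identifies `E` with a bicrossed product. -/
theorem exists_matchedPair_of_linearEquiv {E : Type*} [Ring E] [Algebra k E]
    (i : A →ₐ[k] E) (j : V →ₗ[k] E) (hj : ∀ x y : V, j (x * y) = j x * j y)
    (e : (A × V) ≃ₗ[k] E) (he : ∀ p, e p = i p.1 + j p.2) :
    ∃ (mp : MatchedPair k A V) (φ : E ≃ₗ[k] (A × V)),
      (∀ x y : E, φ (x * y) = mp.mul (φ x) (φ y)) ∧ φ 1 = ((1 : A), (0 : V)) := by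
  let pA : E →ₗ[k] A := LinearMap.fst k A V ∘ₗ e.symm.toLinearMap
  let pV : E →ₗ[k] V := LinearMap.snd k A V ∘ₗ e.symm.toLinearMap
  have hp (z : E) : z = i (pA z) + j (pV z) := by
    simpa [pA, pV] using (e.apply_symm_apply z).symm.trans (he (e.symm z))
  have hinj (a b : A) (x y : V) (h : i a + j x = i b + j y) : a = b ∧ x = y := by
    rw [← he (a, x), ← he (b, y)] at h
    exact Prod.ext_iff.mp (e.injective h)
  let lm := (LinearMap.mul k E).compl₁₂ i.toLinearMap j
  let rm := (LinearMap.mul k E).compl₁₂ j i.toLinearMap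
  have hij (a : A) (x : V) : i a * j x = i (lm.compr₂ pA a x) + j (lm.compr₂ pV a x) := hp _
  have hji (x : V) (a : A) : j x * i a = i (rm.compr₂ pA x a) + j (rm.compr₂ pV x a) := hp _
  refine ⟨.ofMulEq i j hj hinj _ _ _ _ hij hji, e.symm, fun x y => ?_, ?_⟩
  · rw [e.symm_apply_eq]
    obtain ⟨⟨a, x⟩, rfl⟩ := e.surjective x
    obtain ⟨⟨b, y⟩, rfl⟩ := e.surjective y
    simp only [e.symm_apply_apply]
    simp only [he, MatchedPair.mul, MatchedPair.ofMulEq, add_mul, mul_add,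
      map_add, map_mul, hj, hij, hji]
    abel
  · simp [e.symm_apply_eq, he]

/-- **Corollary (the factorization problem)**.  A unital algebra `E` factorizes through
`A` and `V` (that is, `E` contains `A` as a unital subalgebra and `V` as a subalgebra
such that `E = A + V` and `A ∩ V = 0`) if and only if there is a matched pair of algebras
`(A, V, ⊲, ⊳, ↼, ⇀)` such that `E ≅ A ⋈ V`, the bicrossed product. -/
theorem factorization_iff_bicrossed_product
    {k : Type u} [Field k] {A : Type v} [Ring A] [Algebra k A]
    {V : Type w} [NonUnitalRing V] [Module k V] [IsScalarTower k V V] [SMulCommClass k V V]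
    {E : Type v} [Ring E] [Algebra k E] :
    (∃ (i : A →ₐ[k] E) (j : V →ₗ[k] E),
        Function.Injective i ∧ Function.Injective j ∧
        (∀ x y : V, j (x * y) = j x * j y) ∧
        IsCompl (LinearMap.range i.toLinearMap) (LinearMap.range j)) ↔
      ∃ (mp : MatchedPair k A V) (φ : E ≃ₗ[k] (A × V)),
        (∀ x y : E, φ (x * y) = mp.mul (φ x) (φ y)) ∧
        φ 1 = ((1 : A), (0 : V)) := by
  constructor
  · rintro ⟨i, j, hi, hj, hmul, hc⟩
    let e := ((LinearEquiv.ofInjective i.toLinearMap hi).prodCongr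
      (LinearEquiv.ofInjective j hj)).trans (Submodule.prodEquivOfIsCompl _ _ hc)
    exact exists_matchedPair_of_linearEquiv i j hmul e fun _ => rfl
  · rintro ⟨mp, φ, hmul, hone⟩
    let i : A →ₐ[k] E := AlgHom.ofLinearMap (φ.symm.toLinearMap ∘ₗ LinearMap.inl k A V)
      (by simp [φ.symm_apply_eq, hone])
      (fun a b => by simp [φ.symm_apply_eq, hmul, MatchedPair.mul])
    let j : V →ₗ[k] E := φ.symm.toLinearMap ∘ₗ LinearMap.inr k A V
    refine ⟨i, j, φ.symm.injective.comp LinearMap.inl_injective,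
      φ.symm.injective.comp LinearMap.inr_injective,
      fun x y => by simp [j, φ.symm_apply_eq, hmul, MatchedPair.mul], ?_⟩
    have hi : i.toLinearMap = φ.symm.toLinearMap ∘ₗ LinearMap.inl k A V := rfl
    rw [hi, LinearMap.range_comp, LinearMap.range_comp]
    exact LinearMap.isCompl_range_inl_inr.map (Submodule.orderIsoMapComap φ.symm)
end

section
/- Let A be a unital associative k-algebra and let (Λ, λ, D, d, a₀, u) and (Λ', λ', D', d', a'₀, u') be two flag datums of A. Then there exists a k-algebra isomorphism A ⋉_{(Λ, λ, D, d, a₀, u)} x → A ⋉_{(Λ', λ', D', d', a'₀, u')} x that stabilizes A (i.e. fixes every element of A × {0}) if and only if Λ = Λ', λ = λ' and there exists a pair (q, α) ∈ k* × A such that for all a ∈ A: D(a) = q D'(a) + α a − Λ(a) α; d(a) = q d'(a) + a α − λ(a) α; a₀ = q² a'₀ + α² − u α + q d'(α) + q D'(α); u = q u' + λ'(α) + Λ'(α). Consequently this relation is an equivalence relation on the set of flag datums of A, and the assignment (Λ, λ, D, d, a₀, u) ↦ A ⋉_{(Λ, λ, D, d, a₀, u)} x induces a bijection between its set of equivalence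 classes and the set of isomorphism classes (under isomorphisms stabilizing A) of unital associative k-algebra structures on A ⊕ k containing A as a subalgebra of codimension 1. -/
universe u v

/-- The data `(Λ, λ, D, d, a₀, u)` of a (prospective) flag datum of the algebra `A`. -/
structure FlagMaps (k : Type u) (A : Type v) [Field k] [Ring A] [Algebra k A] where
  /-- `Λ : A → k` -/
  Lam : A →ₗ[k] k
  /-- `λ : A → k` -/
  lam : A →ₗ[k] k
  /-- `D : A → A` -/
  Dm : A →ₗ[k] A
  /-- `d : A → A` -/
  dm : A →ₗ[k] A
  /-- `a₀ ∈ A` -/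
  a0 : A
  /-- `u ∈ k` -/
  u : k

namespace FlagMaps

variable {k : Type u} {A : Type v} [Field k] [Ring A] [Algebra k A] (F : FlagMaps k A)

/-- `(Λ, λ, D, d, a₀, u)` is a flag datum of `A`:  `Λ, λ` are algebra maps and the
compatibility conditions of Definition 3.2 hold. -/
def IsFlagDatum : Prop :=
  F.Lam 1 = 1 ∧ (∀ a b : A, F.Lam (a * b) = F.Lam a * F.Lam b) ∧
  F.lam 1 = 1 ∧ (∀ a b : A, F.lam (a * b) = F.lam a * F.lam b) ∧
  F.Lam F.a0 = F.lam F.a0 ∧ F.Dm F.a0 = F.dm F.a0 ∧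
  (∀ a : A, F.lam (F.dm a) = 0) ∧ (∀ a : A, F.Lam (F.Dm a) = 0) ∧
  (∀ a b : A, F.dm (a * b) = a * F.dm b + F.lam b • F.dm a) ∧
  (∀ a b : A, F.Dm (a * b) = F.Lam a • F.Dm b + F.Dm a * b) ∧
  (∀ a : A, F.dm (F.dm a) = F.u • F.dm a + a * F.a0 - F.lam a • F.a0) ∧
  (∀ a : A, F.Dm (F.Dm a) = F.u • F.Dm a + F.a0 * a - F.Lam a • F.a0) ∧
  (∀ a : A, F.Dm (F.dm a) - F.dm (F.Dm a) = (F.Lam a - F.lam a) • F.a0) ∧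
  (∀ a : A, F.Lam (F.dm a) - F.lam (F.Dm a) = (F.Lam a - F.lam a) * F.u) ∧
  (∀ a b : A, a * F.Dm b + F.Lam b • F.dm a = F.dm a * b + F.lam a • F.Dm b)

/-- The multiplication of the algebra `A ⋉_{(Λ,λ,D,d,a₀,u)} x` on `A × k`. -/
def mul (p q : A × k) : A × k :=
  (p.1 * q.1 + q.2 • F.dm p.1 + p.2 • F.Dm q.1 + (p.2 * q.2) • F.a0,
   F.lam p.1 * q.2 + F.Lam q.1 * p.2 + p.2 * q.2 * F.u)

end FlagMaps

/-- A unital associative `k`-algebra structure on the `k`-vector space `E`. -/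
structure AlgStructOn (k : Type u) (E : Type v) [Field k] [AddCommGroup E] [Module k E] where
  mul : E → E → E
  one : E
  mul_add' : ∀ x y z : E, mul x (y + z) = mul x y + mul x z
  add_mul' : ∀ x y z : E, mul (x + y) z = mul x z + mul y z
  smul_mul' : ∀ (c : k) (x y : E), mul (c • x) y = c • mul x y
  mul_smul' : ∀ (c : k) (x y : E), mul x (c • y) = c • mul x y
  mul_assoc' : ∀ x y z : E, mul (mul x y) z = mul x (mul y z)
  one_mul' : ∀ x : E, mul one x = x
  mul_one' : ∀ x : E, mul x one = x

variable {k : Type u} {A : Type v} [Field k] [Ring A] [Algebra k A]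

/-- The equivalence relation `≡` on the set of flag datums of `A` (Theorem 3.4). -/
def FlagRel (F F' : FlagMaps k A) : Prop :=
  F.Lam = F'.Lam ∧ F.lam = F'.lam ∧
  ∃ (q : k) (α : A), q ≠ 0 ∧
    (∀ a : A, F.Dm a = q • F'.Dm a + α * a - F.Lam a • α) ∧
    (∀ a : A, F.dm a = q • F'.dm a + a * α - F.lam a • α) ∧
    F.a0 = (q ^ 2) • F'.a0 + α ^ 2 - F.u • α + q • F'.dm α + q • F'.Dm α ∧
    F.u = q * F'.u + F'.lam α + F'.Lam α

namespace FlagMaps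

/-- The linear automorphism of `A × k` that fixes `A` and sends `x = (0, 1)` to `(α, q)`. -/
def stabilizingEquiv (q : k) (hq : q ≠ 0) (α : A) : (A × k) ≃ₗ[k] (A × k) where
  toFun p := (p.1 + p.2 • α, p.2 * q)
  invFun p := (p.1 - (p.2 * q⁻¹) • α, p.2 * q⁻¹)
  map_add' p r := by
    ext
    · simp only [Prod.fst_add, Prod.snd_add]; module
    · simp only [Prod.snd_add]; ring
  map_smul' c p := by
    ext
    · simp only [Prod.smul_fst, Prod.smul_snd, smul_eq_mul, RingHom.id_apply]; module
    · simp only [Prod.smul_snd, smul_eq_mul, RingHom.id_apply]; ring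
  left_inv p := by ext <;> simp [hq]
  right_inv p := by ext <;> simp [hq]

theorem stabilizingEquiv_apply (q : k) (hq : q ≠ 0) (α : A) (p : A × k) :
    stabilizingEquiv q hq α p = (p.1 + p.2 • α, p.2 * q) := rfl

theorem apply_eq_of_fixes (ψ : (A × k) ≃ₗ[k] (A × k)) (hψ : ∀ a : A, ψ (a, 0) = (a, 0))
    (p : A × k) :
    ψ p = (p.1 + p.2 • (ψ (0, 1)).1, p.2 * (ψ (0, 1)).2) := by
  have hp : p = (p.1, 0) + p.2 • ((0 : A), (1 : k)) := by ext <;> simp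
  conv_lhs => rw [hp, map_add, map_smul, hψ]
  ext <;> simp

theorem snd_ne_zero_of_fixes (ψ : (A × k) ≃ₗ[k] (A × k)) (hψ : ∀ a : A, ψ (a, 0) = (a, 0)) :
    (ψ (0, 1)).2 ≠ 0 := by
  intro h
  have h1 : ψ (0, 1) = ψ ((ψ (0, 1)).1, 0) := by
    rw [hψ]; ext <;> simp [h]
  have h2 := congrArg Prod.snd (ψ.injective h1)
  simp at h2

/-- An isomorphism stabilizing `A` yields the relation on the data. -/
theorem flagRel_of_equiv {F F' : FlagMaps k A} (ψ : (A × k) ≃ₗ[k] (A × k))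
    (hmul : ∀ p q : A × k, ψ (F.mul p q) = F'.mul (ψ p) (ψ q))
    (hψ : ∀ a : A, ψ (a, 0) = (a, 0)) : FlagRel F F' := by
  have hq := snd_ne_zero_of_fixes ψ hψ
  have happ := apply_eq_of_fixes ψ hψ
  generalize (ψ (0, 1)).2 = q at hq happ
  generalize (ψ (0, 1)).1 = α at happ
  have hax (a : A) := hmul (a, 0) (0, 1)
  have hxa (a : A) := hmul (0, 1) (a, 0)
  have hxx := hmul (0, 1) (0, 1)
  simp only [happ, mul, Prod.mk.injEq, mul_zero, zero_mul, zero_smul, one_smul, map_zero,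
    smul_zero, add_zero, zero_add, one_mul, mul_one] at hax hxa hxx
  have hu : F.u = q * F'.u + F'.lam α + F'.Lam α :=
    mul_right_cancel₀ hq (by linear_combination hxx.2)
  refine ⟨LinearMap.ext fun a => mul_right_cancel₀ hq (hxa a).2,
    LinearMap.ext fun a => mul_right_cancel₀ hq (hax a).2,
    q, α, hq, fun a => ?_, fun a => ?_, ?_, hu⟩
  · rw [eq_sub_iff_add_eq, (hxa a).1, add_comm]
  · rw [eq_sub_iff_add_eq, (hax a).1, add_comm]
  · rw [eq_sub_of_add_eq hxx.1, pow_two, pow_two]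
    abel

/-- The relation on the data yields an isomorphism stabilizing `A`. -/
theorem exists_equiv_of_flagRel {F F' : FlagMaps k A} (h : FlagRel F F') :
    ∃ ψ : (A × k) ≃ₗ[k] (A × k),
      (∀ p q : A × k, ψ (F.mul p q) = F'.mul (ψ p) (ψ q)) ∧
      (∀ a : A, ψ (a, 0) = (a, 0)) := by
  obtain ⟨hLam, hlam, q, α, hq, hD, hd, ha0, hu⟩ := h
  refine ⟨stabilizingEquiv q hq α, fun p r => ?_, fun a => by simp [stabilizingEquiv_apply]⟩
  ext
  · simp only [stabilizingEquiv_apply, mul, hD, hd, ha0, map_add, map_smul, hLam, hlam,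
      add_mul, mul_add, smul_mul_assoc, mul_smul_comm, pow_two]
    module
  · simp only [stabilizingEquiv_apply, mul, hu, map_add, map_smul, hLam, hlam, smul_eq_mul]
    ring

theorem exists_equiv_iff_flagRel (F F' : FlagMaps k A) :
    (∃ ψ : (A × k) ≃ₗ[k] (A × k),
      (∀ p q : A × k, ψ (F.mul p q) = F'.mul (ψ p) (ψ q)) ∧
      (∀ a : A, ψ (a, 0) = (a, 0))) ↔ FlagRel F F' :=
  ⟨fun ⟨ψ, hmul, hψ⟩ => flagRel_of_equiv ψ hmul hψ, exists_equiv_of_flagRel⟩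

theorem flagRel_equivalence : Equivalence (FlagRel (k := k) (A := A)) where
  refl F := flagRel_of_equiv (LinearEquiv.refl k _) (fun _ _ => rfl) fun _ => rfl
  symm h := by
    obtain ⟨ψ, hmul, hψ⟩ := exists_equiv_of_flagRel h
    refine flagRel_of_equiv ψ.symm (fun p q => ?_) fun a => ?_
    · rw [LinearEquiv.symm_apply_eq, hmul, ψ.apply_symm_apply, ψ.apply_symm_apply]
    · rw [LinearEquiv.symm_apply_eq, hψ]
  trans h h' := by
    obtain ⟨ψ, hmul, hψ⟩ := exists_equiv_of_flagRel h
    obtain ⟨φ, hmul', hφ⟩ := exists_equiv_of_flagRel h'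
    refine flagRel_of_equiv (ψ.trans φ) (fun p q => ?_) fun a => ?_
    · simp only [LinearEquiv.trans_apply, hmul, hmul']
    · simp only [LinearEquiv.trans_apply, hψ, hφ]

/-- Associativity and unitality of the multiplication force the flag datum axioms. -/
theorem isFlagDatum_of_mul_assoc (F : FlagMaps k A)
    (assoc : ∀ x y z : A × k, F.mul (F.mul x y) z = F.mul x (F.mul y z))
    (one_mul' : ∀ x : A × k, F.mul (1, 0) x = x) (mul_one' : ∀ x : A × k, F.mul x (1, 0) = x) :
    F.IsFlagDatum := by
  have h1 := one_mul' (0, 1)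
  have h2 := mul_one' (0, 1)
  have haax (a b : A) := assoc (a, 0) (b, 0) (0, 1)
  have hxaa (a b : A) := assoc (0, 1) (a, 0) (b, 0)
  have haxa (a b : A) := assoc (a, 0) (0, 1) (b, 0)
  have haxx (a : A) := assoc (a, 0) (0, 1) (0, 1)
  have hxxa (a : A) := assoc (0, 1) (0, 1) (a, 0)
  have hxax (a : A) := assoc (0, 1) (a, 0) (0, 1)
  have hxxx := assoc (0, 1) (0, 1) (0, 1)
  simp only [mul, Prod.mk.injEq, mul_zero, zero_mul, zero_smul, one_smul, map_zero,
    smul_zero, add_zero, zero_add, one_mul, mul_one] at h1 h2 haax hxaa haxa haxx hxxa hxax hxxx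
  refine ⟨h2.2, fun a b => ?_, h1.2, fun a b => (haax a b).2, ?_, ?_, fun a => ?_, fun a => ?_,
    fun a b => (haax a b).1, fun a b => ?_, fun a => ?_, fun a => ?_, fun a => ?_, fun a => ?_,
    fun a b => ?_⟩
  · linear_combination -(hxaa a b).2
  · linear_combination -hxxx.2
  · linear_combination (norm := module) -hxxx.1
  · linear_combination (haxx a).2
  · linear_combination -(hxxa a).2
  · linear_combination (norm := module) -(hxaa a b).1
  · linear_combination (norm := module) (haxx a).1
  · linear_combination (norm := module) -(hxxa a).1
  · linear_combination (norm := module) -(hxax a).1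
  · linear_combination -(hxax a).2
  · linear_combination (norm := module) -(haxa a b).1

end FlagMaps

namespace AlgStructOn

variable (S : AlgStructOn k (A × k))

/-- The data read off from the products `a x`, `x a` and `x²` with `x = (0, 1)`. -/
def toFlagMaps : FlagMaps k A :=
  let R : (A × k) →ₗ[k] (A × k) :=
    { toFun := fun p => S.mul p (0, 1)
      map_add' := fun p q => S.add_mul' p q _
      map_smul' := fun c p => S.smul_mul' c p _ }
  let L : (A × k) →ₗ[k] (A × k) :=
    { toFun := fun p => S.mul (0, 1) p
      map_add' := fun p q => S.mul_add' _ p q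
      map_smul' := fun c p => S.mul_smul' c _ p }
  { Lam := LinearMap.snd k A k ∘ₗ L ∘ₗ LinearMap.inl k A k
    lam := LinearMap.snd k A k ∘ₗ R ∘ₗ LinearMap.inl k A k
    Dm := LinearMap.fst k A k ∘ₗ L ∘ₗ LinearMap.inl k A k
    dm := LinearMap.fst k A k ∘ₗ R ∘ₗ LinearMap.inl k A k
    a0 := (S.mul (0, 1) (0, 1)).1
    u := (S.mul (0, 1) (0, 1)).2 }

theorem mul_eq_toFlagMaps_mul (hA : ∀ a b : A, S.mul (a, 0) (b, 0) = (a * b, 0))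
    (p q : A × k) : S.mul p q = S.toFlagMaps.mul p q := by
  have h (r : A × k) : r = (r.1, 0) + r.2 • ((0 : A), (1 : k)) := by ext <;> simp
  conv_lhs =>
    rw [h p, h q, S.add_mul', S.mul_add', S.mul_add', S.smul_mul', S.smul_mul', S.mul_smul',
      S.mul_smul', hA]
  ext
  · simp only [FlagMaps.mul, toFlagMaps, Prod.fst_add, Prod.smul_fst, LinearMap.comp_apply,
      LinearMap.inl_apply, LinearMap.fst_apply, LinearMap.coe_mk, AddHom.coe_mk]
    module
  · simp only [FlagMaps.mul, toFlagMaps, Prod.snd_add, Prod.smul_snd, LinearMap.comp_apply,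
      LinearMap.inl_apply, LinearMap.snd_apply, LinearMap.coe_mk, AddHom.coe_mk, smul_eq_mul]
    ring

theorem isFlagDatum_toFlagMaps (hA : ∀ a b : A, S.mul (a, 0) (b, 0) = (a * b, 0))
    (hone : S.one = ((1 : A), (0 : k))) : S.toFlagMaps.IsFlagDatum := by
  refine FlagMaps.isFlagDatum_of_mul_assoc _ (fun x y z => ?_) (fun x => ?_) fun x => ?_
  · simpa only [S.mul_eq_toFlagMaps_mul hA] using S.mul_assoc' x y z
  · rw [← S.mul_eq_toFlagMaps_mul hA, ← hone, S.one_mul']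
  · rw [← S.mul_eq_toFlagMaps_mul hA, ← hone, S.mul_one']

end AlgStructOn

/-- **Theorem 3.4 (1)**:  two flag datums of `A` give algebra structures on `A ⊕ k`
isomorphic via an isomorphism stabilizing `A` precisely when they are related by `≡`;
consequently `≡` is an equivalence relation on the set of flag datums, and
`(Λ,λ,D,d,a₀,u) ↦ A ⋉_{(Λ,λ,D,d,a₀,u)} x` induces a bijection between the set of its
equivalence classes and the set of isomorphism classes (under isomorphisms stabilizing
`A`) of algebra structures on `A ⊕ k` containing `A` as a subalgebra of codimension 1. -/
theorem flag_datum_classification :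
    (∀ F F' : FlagMaps k A, F.IsFlagDatum → F'.IsFlagDatum →
      ((∃ ψ : (A × k) ≃ₗ[k] (A × k),
          (∀ p q : A × k, ψ (F.mul p q) = F'.mul (ψ p) (ψ q)) ∧
          (∀ a : A, ψ (a, 0) = (a, 0))) ↔ FlagRel F F')) ∧
    Equivalence (fun F F' : {F : FlagMaps k A // F.IsFlagDatum} => FlagRel F.1 F'.1) ∧
    (∀ S : AlgStructOn k (A × k),
      (∀ a b : A, S.mul (a, 0) (b, 0) = (a * b, 0)) → S.one = ((1 : A), (0 : k)) →
      ∃ F : FlagMaps k A, F.IsFlagDatum ∧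
        ∃ ψ : (A × k) ≃ₗ[k] (A × k),
          (∀ p q : A × k, ψ (S.mul p q) = F.mul (ψ p) (ψ q)) ∧
          (∀ a : A, ψ (a, 0) = (a, 0))) := by
  refine ⟨fun F F' _ _ => FlagMaps.exists_equiv_iff_flagRel F F',
    FlagMaps.flagRel_equivalence.comap Subtype.val, fun S hA hone => ?_⟩
  exact ⟨S.toFlagMaps, S.isFlagDatum_toFlagMaps hA hone, LinearEquiv.refl k _,
    S.mul_eq_toFlagMaps_mul hA, fun _ => rfl⟩
end

section
/- Let A be a unital associative k-algebra and (Λ, λ, D, d, a₀, u) a flag datum of A. Then the Galois group Gal(A ⋉_{(Λ, λ, D, d, a₀, u)} x / A) is isomorphic, as a group, to the set 𝔾_A(Λ, λ, D, d, a₀, u) of all pairs (α, q) ∈ A × k* such that for all a ∈ A: (1 − q) D(a) = α a − Λ(a) α; (1 − q) d(a) = a α − λ(a) α; (1 − q²) a₀ = α² − u α + q d(α) + q D(α); (1 − q) u = λ(α) + Λ(α), equipped with the multiplication (α, q) · (α', q') := (α' + q' α, q q'). -/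
universe u v

variable {k : Type u} {A : Type v} [Field k] [Ring A] [Algebra k A]

namespace FlagMaps

/-- The linear automorphism `(a, c) ↦ (a + c α, q c)` of `A × k`. -/
def shearScale (α : A) (q : k) (hq : q ≠ 0) : (A × k) ≃ₗ[k] (A × k) where
  toFun x := (x.1 + x.2 • α, q * x.2)
  map_add' x y := by
    ext
    · simp only [Prod.fst_add, Prod.snd_add]
      module
    · simp only [Prod.snd_add]
      ring
  map_smul' c x := by
    ext
    · simp only [Prod.smul_fst, Prod.smul_snd, smul_eq_mul, RingHom.id_apply]
      module
    · simp only [Prod.smul_snd, smul_eq_mul, RingHom.id_apply]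
      ring
  invFun x := (x.1 - (q⁻¹ * x.2) • α, q⁻¹ * x.2)
  left_inv x := by simp [hq]
  right_inv x := by simp [hq]

@[simp]
theorem shearScale_apply (α : A) (q : k) (hq : q ≠ 0) (a : A) (c : k) :
    shearScale α q hq (a, c) = (a + c • α, q * c) := rfl

/-- A linear automorphism of `A × k` fixing `A` is determined by the image of `(0, 1)`. -/
theorem apply_eq_of_fixes_s13 {σ : (A × k) ≃ₗ[k] (A × k)} (hσ : ∀ a : A, σ (a, 0) = (a, 0))
    (a : A) (c : k) :
    σ (a, c) = (a + c • (σ (0, 1)).1, (σ (0, 1)).2 * c) := by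
  have h : ((a, c) : A × k) = (a, 0) + c • (0, 1) := by simp
  rw [h, map_add, map_smul, hσ]
  ext <;> simp [mul_comm]

theorem snd_apply_ne_zero_of_fixes {σ : (A × k) ≃ₗ[k] (A × k)}
    (hσ : ∀ a : A, σ (a, 0) = (a, 0)) : (σ (0, 1)).2 ≠ 0 := by
  intro h
  have h' : σ (0, 1) = σ ((σ (0, 1)).1, 0) := by
    rw [hσ]
    exact Prod.ext rfl h
  exact one_ne_zero (congrArg Prod.snd (σ.injective h'))

/-- The map `(a, c) ↦ (a + c α, q c)` is multiplicative exactly when `(α, q)` satisfies the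
four conditions defining `𝔾_A`. -/
theorem shearScale_mul_iff (F : FlagMaps k A) (α : A) (q : k) (hq : q ≠ 0) :
    (∀ x y : A × k, shearScale α q hq (F.mul x y)
        = F.mul (shearScale α q hq x) (shearScale α q hq y)) ↔
      (∀ a : A, (1 - q) • F.Dm a = α * a - F.Lam a • α) ∧
      (∀ a : A, (1 - q) • F.dm a = a * α - F.lam a • α) ∧
      ((1 - q ^ 2) • F.a0 = α ^ 2 - F.u • α + q • F.dm α + q • F.Dm α) ∧
      ((1 - q) * F.u = F.lam α + F.Lam α) := by
  constructor
  · intro h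
    refine ⟨fun a => ?_, fun a => ?_, ?_, ?_⟩
    · have h' := congrArg Prod.fst (h (0, 1) (a, 0))
      simp [mul] at h'
      linear_combination (norm := module) h'
    · have h' := congrArg Prod.fst (h (a, 0) (0, 1))
      simp [mul] at h'
      linear_combination (norm := module) h'
    · have h' := congrArg Prod.fst (h (0, 1) (0, 1))
      simp [mul] at h'
      rw [pow_two α]
      linear_combination (norm := module) h'
    · have h' := congrArg Prod.snd (h (0, 1) (0, 1))
      simp [mul] at h'
      apply mul_left_cancel₀ hq
      linear_combination h'
  · rintro ⟨hD, hd, ha, hu⟩ ⟨a, c⟩ ⟨b, e⟩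
    rw [pow_two α] at ha
    ext
    · simp only [mul, shearScale_apply, map_add, map_smul, add_mul, mul_add, smul_mul_assoc,
        mul_smul_comm]
      linear_combination (norm := module) c • hD b + e • hd a + (c * e) • ha
    · simp only [mul, shearScale_apply, map_add, map_smul, smul_eq_mul]
      linear_combination (q * c * e) * hu

end FlagMaps

/-- **Corollary (the Galois group in codimension 1)**.  For a flag datum
`(Λ, λ, D, d, a₀, u)` of `A`, the Galois group
`Gal(A ⋉_{(Λ,λ,D,d,a₀,u)} x / A)` — the group of algebra automorphisms of
`A ⋉_{(Λ,λ,D,d,a₀,u)} x` fixing `A` pointwise — is isomorphic to the group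
`𝔾_A(Λ, λ, D, d, a₀, u)` of all pairs `(α, q) ∈ A × k*` satisfying the four displayed
conditions, with multiplication `(α, q) · (α', q') = (α' + q' α, q q')`.  The
isomorphism sends `(α, q)` to the automorphism `(a, c) ↦ (a + c α, q c)`. -/
theorem galois_group_codimension_one (F : FlagMaps k A) (hF : F.IsFlagDatum) :
    ∃ e : {p : A × k // p.2 ≠ 0 ∧
        (∀ a : A, (1 - p.2) • F.Dm a = p.1 * a - F.Lam a • p.1) ∧
        (∀ a : A, (1 - p.2) • F.dm a = a * p.1 - F.lam a • p.1) ∧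
        ((1 - p.2 ^ 2) • F.a0
          = p.1 ^ 2 - F.u • p.1 + p.2 • F.dm p.1 + p.2 • F.Dm p.1) ∧
        ((1 - p.2) * F.u = F.lam p.1 + F.Lam p.1)} ≃
      {σ : (A × k) ≃ₗ[k] (A × k) //
        (∀ p q : A × k, σ (F.mul p q) = F.mul (σ p) (σ q)) ∧
        (∀ a : A, σ (a, 0) = (a, 0))},
      -- the isomorphism is `(α, q) ↦ ((a, c) ↦ (a + c α, q c))` …
      (∀ p, ∀ (a : A) (c : k), ((e p : _) : (A × k) ≃ₗ[k] (A × k)) (a, c)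
          = (a + c • p.1.1, p.1.2 * c)) ∧
      -- … and it transports the multiplication `(α, q)·(α', q') = (α' + q' α, q q')`
      -- to the composition of automorphisms
      (∀ p q pq, (pq : {p : A × k // _}).1 = (q.1.1 + q.1.2 • p.1.1, p.1.2 * q.1.2) →
        ((e pq : _) : (A × k) ≃ₗ[k] (A × k))
          = ((e q : _) : (A × k) ≃ₗ[k] (A × k)).trans
              ((e p : _) : (A × k) ≃ₗ[k] (A × k))) := by
  refine ⟨
    { toFun := fun p => ⟨FlagMaps.shearScale p.1.1 p.1.2 p.2.1,
        (F.shearScale_mul_iff p.1.1 p.1.2 p.2.1).2 p.2.2, fun a => by simp⟩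
      invFun := fun σ => ⟨σ.1 (0, 1), FlagMaps.snd_apply_ne_zero_of_fixes σ.2.2,
        (F.shearScale_mul_iff _ _ (FlagMaps.snd_apply_ne_zero_of_fixes σ.2.2)).1 ?_⟩
      left_inv := fun p => by
        apply Subtype.ext
        simp
      right_inv := fun σ => by
        apply Subtype.ext
        ext1 ⟨a, c⟩
        exact (FlagMaps.apply_eq_of_fixes_s13 σ.2.2 a c).symm }, fun _ _ _ => rfl, ?_⟩
  · have h : FlagMaps.shearScale (σ.1 (0, 1)).1 (σ.1 (0, 1)).2
        (FlagMaps.snd_apply_ne_zero_of_fixes σ.2.2) = σ.1 := by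
      ext1 ⟨a, c⟩
      exact (FlagMaps.apply_eq_of_fixes_s13 σ.2.2 a c).symm
    rw [h]
    exact σ.2.1
  · rintro p q ⟨pq, hpq⟩ rfl
    ext1 ⟨a, c⟩
    ext
    · simp only [Equiv.coe_fn_mk, LinearEquiv.trans_apply, FlagMaps.shearScale_apply]
      module
    · simp only [Equiv.coe_fn_mk, LinearEquiv.trans_apply, FlagMaps.shearScale_apply]
      ring
end

section
/- Let k be an arbitrary field. Every 2-dimensional unital associative k-algebra is isomorphic to k_(a,b) for some (a, b) ∈ k × k, and for (a, b), (a', b') ∈ k × k the algebras k_(a,b) and k_(a',b') are isomorphic as k-algebras if and only if there exists a pair (q, α) ∈ k* × k such that a = q² a' + α² − b α and b = q b' + 2 α. In particular, the set of isomorphism classes of 2-dimensional unital associative k-algebras is in bijection with the quotient of k × k by this equivalence relation. -/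
universe u v

open Polynomial

/-- The 2-dimensional algebra `k_(a,b) = k[X]/(X² − bX − a)`, with basis `{1, x}` and
`x² = a·1 + b·x`. -/
noncomputable abbrev kTwoDim (k : Type u) [Field k] (a b : k) : Type u :=
  AdjoinRoot (X ^ 2 - C b * X - C a : Polynomial k)

section QuadraticGenerator

variable {k : Type u} [Field k] {B : Type v} [Ring B] [Algebra k B]

/-- A non-scalar element is linearly independent from `1`. -/
theorem linearIndependent_one_of_notMem_range [Nontrivial B] {x : B}
    (hx : x ∉ Set.range (algebraMap k B)) : LinearIndependent k ![1, x] := by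
  rw [LinearIndependent.pair_iff' one_ne_zero]
  intro c hc
  exact hx ⟨c, by rw [Algebra.algebraMap_eq_smul_one, hc]⟩

theorem exists_eq_algebraMap_add_smul (hB : Module.finrank k B = 2) {x : B}
    (hx : x ∉ Set.range (algebraMap k B)) (y : B) :
    ∃ c d : k, y = algebraMap k B c + d • x := by
  have : Nontrivial B := Module.nontrivial_of_finrank_pos (R := k) (by omega)
  have hspan := (linearIndependent_one_of_notMem_range hx).span_eq_top_of_card_eq_finrank
    (by simp [hB])
  have hy : y ∈ Submodule.span k (Set.range ![1, x]) := hspan ▸ Submodule.mem_top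
  rw [Matrix.range_cons, Matrix.range_cons, Matrix.range_empty, Set.union_empty,
    Set.singleton_union, Submodule.mem_span_pair] at hy
  obtain ⟨c, d, h⟩ := hy
  exact ⟨c, d, by rw [← h, Algebra.algebraMap_eq_smul_one]⟩

theorem exists_notMem_range_algebraMap (hB : Module.finrank k B = 2) :
    ∃ x : B, x ∉ Set.range (algebraMap k B) := by
  by_contra! h
  have hbot : (⊥ : Subalgebra k B) = ⊤ :=
    eq_top_iff.2 fun x _ => Algebra.mem_bot.2 (h x)
  have : Nontrivial B := Module.nontrivial_of_finrank_pos (R := k) (by omega)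
  rw [Subalgebra.bot_eq_top_iff_finrank_eq_one] at hbot
  omega

variable (k) in
theorem kTwoDim_monic (a b : k) : (X ^ 2 - C b * X - C a : k[X]).Monic := by
  monicity!

variable (k) in
theorem kTwoDim_natDegree (a b : k) : (X ^ 2 - C b * X - C a : k[X]).natDegree = 2 := by
  compute_degree!

theorem finrank_kTwoDim (a b : k) : Module.finrank k (kTwoDim k a b) = 2 := by
  rw [(AdjoinRoot.powerBasis' (kTwoDim_monic k a b)).finrank, AdjoinRoot.powerBasis'_dim,
    kTwoDim_natDegree]

theorem kTwoDim_root_notMem_range (a b : k) :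
    AdjoinRoot.root (X ^ 2 - C b * X - C a : k[X]) ∉
      Set.range (algebraMap k (kTwoDim k a b)) := by
  rintro ⟨c, hc⟩
  have h : AdjoinRoot.mk (X ^ 2 - C b * X - C a : k[X]) (X - C c) = 0 := by
    rw [map_sub, AdjoinRoot.mk_X, AdjoinRoot.mk_C, ← hc, AdjoinRoot.algebraMap_eq, sub_self]
  rw [AdjoinRoot.mk_eq_zero] at h
  have := natDegree_le_of_dvd h (X_sub_C_ne_zero c)
  rw [kTwoDim_natDegree, natDegree_X_sub_C] at this
  omega

theorem kTwoDim_root_mul_self (a b : k) :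
    AdjoinRoot.root (X ^ 2 - C b * X - C a : k[X]) * AdjoinRoot.root _ =
      algebraMap k (kTwoDim k a b) a + b • AdjoinRoot.root _ := by
  have h := AdjoinRoot.mk_self (f := (X ^ 2 - C b * X - C a : k[X]))
  simp only [map_sub, map_mul, map_pow, AdjoinRoot.mk_X, AdjoinRoot.mk_C] at h
  rw [Algebra.smul_def, AdjoinRoot.algebraMap_eq]
  linear_combination h

/-- A 2-dimensional algebra containing a non-scalar `x` with `x² = a + b x` is `k_(a,b)`. -/
theorem nonempty_kTwoDim_algEquiv (hB : Module.finrank k B = 2) {x : B}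
    (hx : x ∉ Set.range (algebraMap k B)) {a b : k}
    (h : x * x = algebraMap k B a + b • x) : Nonempty (kTwoDim k a b ≃ₐ[k] B) := by
  have hroot : aeval x (X ^ 2 - C b * X - C a : k[X]) = 0 := by
    simp [pow_two, h, Algebra.smul_def]
  let f : kTwoDim k a b →ₐ[k] B :=
    Ideal.Quotient.liftₐ (Ideal.span {(X ^ 2 - C b * X - C a : k[X])}) (aeval x) fun p hp => by
      obtain ⟨r, rfl⟩ := Ideal.mem_span_singleton.1 hp
      rw [map_mul, hroot, zero_mul]
  have hf : f (AdjoinRoot.root _) = x := aeval_X x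
  have hsurj : Function.Surjective f := fun y => by
    obtain ⟨c, d, rfl⟩ := exists_eq_algebraMap_add_smul hB hx y
    exact ⟨algebraMap k _ c + d • AdjoinRoot.root _, by
      rw [map_add, map_smul, AlgHom.commutes, hf]⟩
  have : Module.Finite k (kTwoDim k a b) :=
    Module.finite_of_finrank_pos (by rw [finrank_kTwoDim]; omega)
  have : Module.Finite k B := Module.finite_of_finrank_pos (by omega)
  have hinj : Function.Injective f :=
    (LinearMap.injective_iff_surjective_of_finrank_eq_finrank (f := f.toLinearMap)
      (by rw [finrank_kTwoDim, hB])).2 hsurj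
  exact ⟨AlgEquiv.ofBijective f ⟨hinj, hsurj⟩⟩

/-- The relation satisfied by an affine change of generator. -/
theorem affine_mul_self_sub {A : Type v} [CommRing A] [Algebra k A] {y : A} {a' b' : k}
    (h : y * y = algebraMap k A a' + b' • y) (a b q α : k) :
    (algebraMap k A α + q • y) * (algebraMap k A α + q • y) -
        (algebraMap k A a + b • (algebraMap k A α + q • y)) =
      (q ^ 2 * a' + α ^ 2 - b * α - a) • (1 : A) + (q * (q * b' + 2 * α - b)) • y := by
  simp only [Algebra.smul_def, map_add, map_sub, map_mul, map_pow, map_ofNat] at h ⊢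
  linear_combination (algebraMap k A q) ^ 2 * h

/-- The quadratic relations satisfied by the non-scalar elements of a 2-dimensional algebra. -/
theorem exists_quadratic_generator_iff {A : Type v} [CommRing A] [Algebra k A]
    (hA : Module.finrank k A = 2) {y : A} (hy : y ∉ Set.range (algebraMap k A)) {a' b' : k}
    (h : y * y = algebraMap k A a' + b' • y) (a b : k) :
    (∃ z : A, z ∉ Set.range (algebraMap k A) ∧ z * z = algebraMap k A a + b • z) ↔
      ∃ q α : k, q ≠ 0 ∧ a = q ^ 2 * a' + α ^ 2 - b * α ∧ b = q * b' + 2 * α := by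
  constructor
  · rintro ⟨z, hz, hmul⟩
    have : Nontrivial A := Module.nontrivial_of_finrank_pos (R := k) (by omega)
    obtain ⟨α, q, rfl⟩ := exists_eq_algebraMap_add_smul hA hy z
    have hq : q ≠ 0 := by
      rintro rfl
      exact hz ⟨α, by rw [zero_smul, add_zero]⟩
    rw [← sub_eq_zero, affine_mul_self_sub h] at hmul
    have hli := linearIndependent_one_of_notMem_range hy
    rw [LinearIndependent.pair_iff] at hli
    obtain ⟨h₁, h₂⟩ := hli _ _ hmul
    have h₃ := (mul_eq_zero.1 h₂).resolve_left hq
    exact ⟨q, α, hq, by linear_combination -h₁, by linear_combination -h₃⟩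
  · rintro ⟨q, α, hq, ha, hb⟩
    refine ⟨algebraMap k A α + q • y, ?_, ?_⟩
    · rintro ⟨c, hc⟩
      refine hy ⟨q⁻¹ * (c - α), ?_⟩
      rw [map_mul, map_sub, hc, add_sub_cancel_left, ← Algebra.smul_def, inv_smul_smul₀ hq]
    · rw [← sub_eq_zero, affine_mul_self_sub h,
        show q ^ 2 * a' + α ^ 2 - b * α - a = 0 by linear_combination -ha,
        show q * b' + 2 * α - b = 0 by linear_combination -hb, mul_zero, zero_smul, zero_smul,
        add_zero]

end QuadraticGenerator

/-- **Corollary 3.5 (1)**.  Every 2-dimensional unital associative algebra over a field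
`k` is isomorphic to some `k_(a,b)`, and `k_(a,b) ≅ k_(a',b')` if and only if there is a
pair `(q, α) ∈ k* × k` with `a = q²a' + α² − bα` and `b = qb' + 2α`.  In particular the
isomorphism classes of 2-dimensional algebras are in bijection with the quotient of
`k × k` by this equivalence relation. -/
theorem two_dimensional_algebras_classification (k : Type u) [Field k] :
    (∀ (B : Type v) (_ : Ring B) (_ : Algebra k B), Module.finrank k B = 2 →
      ∃ a b : k, Nonempty (B ≃ₐ[k] kTwoDim k a b)) ∧
    (∀ a b a' b' : k,
      Nonempty (kTwoDim k a b ≃ₐ[k] kTwoDim k a' b') ↔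
        ∃ q α : k, q ≠ 0 ∧ a = q ^ 2 * a' + α ^ 2 - b * α ∧ b = q * b' + 2 * α) := by
  refine ⟨fun B _ _ hB => ?_, fun a b a' b' => ?_⟩
  · obtain ⟨x, hx⟩ := exists_notMem_range_algebraMap hB
    obtain ⟨a, b, h⟩ := exists_eq_algebraMap_add_smul hB hx (x * x)
    exact ⟨a, b, (nonempty_kTwoDim_algEquiv hB hx h).map AlgEquiv.symm⟩
  · rw [← exists_quadratic_generator_iff (finrank_kTwoDim a' b')
      (kTwoDim_root_notMem_range a' b') (kTwoDim_root_mul_self a' b')]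
    constructor
    · rintro ⟨e⟩
      refine ⟨e (AdjoinRoot.root _), ?_, ?_⟩
      · rintro ⟨c, hc⟩
        exact kTwoDim_root_notMem_range a b ⟨c, e.injective (by rw [← hc, AlgEquiv.commutes])⟩
      · rw [← map_mul, kTwoDim_root_mul_self, map_add, map_smul, AlgEquiv.commutes]
    · rintro ⟨z, hz, hmul⟩
      exact nonempty_kTwoDim_algEquiv (finrank_kTwoDim a' b') hz hmul
end
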